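/- For every φ ∈ ℝ and every quaternion q ∈ ℍ, the Hopf map satisfies π(e^{iφ}·q) = π(q), where e^{iφ} := cos φ + (sin φ)·i ∈ ℍ. In particular π is constant along the circle fibers {e^{iφ}·q : φ ∈ ℝ}. -/

import Mathlib

noncomputable section

/-- The ℝ-linear involution of ℍ fixing 1, j, k and sending i to −i. -/
def Iinv (q : Quaternion ℝ) : Quaternion ℝ := ⟨q.re, -q.imI, q.imJ, q.imK⟩

/-- The Hopf map π(q) = q̃ · q. -/
def hopfMap (q : Quaternion ℝ) : Quaternion ℝ := Iinv q * q

/-- The quaternion e^{iφ} = cos φ + (sin φ)·i. -/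
def expI (φ : ℝ) : Quaternion ℝ := ⟨Real.cos φ, Real.sin φ, 0, 0⟩

@[simp]
theorem Iinv_re (q : Quaternion ℝ) : (Iinv q).re = q.re := rfl

@[simp]
theorem Iinv_imI (q : Quaternion ℝ) : (Iinv q).imI = -q.imI := rfl

@[simp]
theorem Iinv_imJ (q : Quaternion ℝ) : (Iinv q).imJ = q.imJ := rfl

@[simp]
theorem Iinv_imK (q : Quaternion ℝ) : (Iinv q).imK = q.imK := rfl

@[simp]
theorem expI_re (φ : ℝ) : (expI φ).re = Real.cos φ := rfl

@[simp]
theorem expI_imI (φ : ℝ) : (expI φ).imI = Real.sin φ := rfl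

@[simp]
theorem expI_imJ (φ : ℝ) : (expI φ).imJ = 0 := rfl

@[simp]
theorem expI_imK (φ : ℝ) : (expI φ).imK = 0 := rfl

theorem Iinv_mul (p q : Quaternion ℝ) : Iinv (p * q) = Iinv q * Iinv p := by
  ext <;> simp <;> ring

theorem Iinv_expI_mul_expI (φ : ℝ) : Iinv (expI φ) * expI φ = 1 := by
  apply Quaternion.ext
  · simp [← sq, Quaternion.re_one]
  · simp [mul_comm, Quaternion.imI_one]
  · simp [Quaternion.imJ_one]
  · simp [Quaternion.imK_one]

/-- The Hopf map is invariant under left multiplication by e^{iφ}: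
it is constant along the circle fibers. -/
theorem hopfMap_expI_mul (φ : ℝ) (q : Quaternion ℝ) :
    hopfMap (expI φ * q) = hopfMap q := by
  rw [hopfMap, Iinv_mul, mul_assoc, ← mul_assoc (Iinv (expI φ)), Iinv_expI_mul_expI, one_mul,
    hopfMap]
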